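/- Let Δ ⊂ ℝ^d be a lattice simplex of dimension d with normalized volume Vol(Δ) = 3 which is not a lattice pyramid, and write its δ-polynomial as 1 + t^{i_1} + t^{i_2} with 1 ≤ i_1 ≤ i_2. Then d = i_1 + i_2 − 1 and Δ is unimodularly equivalent to Δ^(3) = conv{0, e_1, …, e_{d−1}, w}, where w = 2·Σ_{i=1, i≠d}^{−i_1+2i_2−1} e_i + Σ_{i=−i_1+2i_2}^{d−1} e_i + 3e_d. -/

import Mathlib

open Pointwise Polynomial

noncomputable section

/-- The set of lattice points of `ℝ^d` (points with integer coordinates). -/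
def latticePts (d : ℕ) : Set (Fin d → ℝ) := {x | ∀ i, ∃ z : ℤ, x i = (z : ℝ)}

/-- A lattice polytope: the convex hull of finitely many lattice points. -/
def IsLatticePolytope {d : ℕ} (P : Set (Fin d → ℝ)) : Prop :=
  ∃ V : Finset (Fin d → ℝ), (V : Set (Fin d → ℝ)) ⊆ latticePts d ∧
    P = convexHull ℝ (V : Set (Fin d → ℝ))

/-- `|nP ∩ ℤ^d|`. -/
def ehrhartCount {d : ℕ} (P : Set (Fin d → ℝ)) (n : ℕ) : ℕ :=
  (latticePts d ∩ (n : ℝ) • P).ncard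

/-- The Ehrhart series `1 + Σ_{n ≥ 1} |nP ∩ ℤ^d| tⁿ`. -/
def ehrhartSeries {d : ℕ} (P : Set (Fin d → ℝ)) : PowerSeries ℤ :=
  PowerSeries.mk fun n => if n = 0 then 1 else (ehrhartCount P n : ℤ)

/-- `p` is the δ-polynomial of the lattice polytope `P ⊆ ℝ^d` of dimension `d`,
i.e. `(1 - t)^(d+1) (1 + Σ_{n ≥ 1} |nP ∩ ℤ^d| tⁿ) = p`. -/
def HasDeltaPoly {d : ℕ} (P : Set (Fin d → ℝ)) (p : Polynomial ℤ) : Prop :=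
  (1 - PowerSeries.X) ^ (d + 1) * ehrhartSeries P = (p : PowerSeries ℤ)

/-- Unimodular equivalence: an affine map carrying `ℤ^d ∩ aff P` bijectively onto
`ℤ^e ∩ aff Q` and mapping `P` onto `Q`. -/
def UnimodEquiv {d e : ℕ} (P : Set (Fin d → ℝ)) (Q : Set (Fin e → ℝ)) : Prop :=
  ∃ f : (Fin d → ℝ) →ᵃ[ℝ] (Fin e → ℝ),
    Set.BijOn f (latticePts d ∩ (affineSpan ℝ P : Set (Fin d → ℝ)))
      (latticePts e ∩ (affineSpan ℝ Q : Set (Fin e → ℝ))) ∧ f '' P = Q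

/-- The lattice pyramid `Pyr(Q) = conv(Q × {0}, (0,…,0,1)) ⊆ ℝ^{e+1}`. -/
def pyramidOver {e : ℕ} (Q : Set (Fin e → ℝ)) : Set (Fin (e + 1) → ℝ) :=
  convexHull ℝ
    ((fun x : Fin e → ℝ => Fin.snoc x (0 : ℝ)) '' Q ∪ {Fin.snoc (0 : Fin e → ℝ) (1 : ℝ)})

/-- `P` is a lattice pyramid over some (full-dimensional) lattice polytope. -/
def IsLatticePyramid {d : ℕ} (P : Set (Fin d → ℝ)) : Prop :=
  ∃ (e : ℕ) (Q : Set (Fin e → ℝ)), IsLatticePolytope Q ∧ affineSpan ℝ Q = ⊤ ∧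
    UnimodEquiv P (pyramidOver Q)

/-- `P ⊆ ℝ^d` is a simplex (of some dimension). -/
def IsSimplex {d : ℕ} (P : Set (Fin d → ℝ)) : Prop :=
  ∃ (n : ℕ) (v : Fin (n + 1) → Fin d → ℝ), AffineIndependent ℝ v ∧
    P = convexHull ℝ (Set.range v)

/-- A full-dimensional lattice simplex of dimension `d` in `ℝ^d`. -/
def IsLatticeSimplexFD {d : ℕ} (Δ : Set (Fin d → ℝ)) : Prop :=
  ∃ v : Fin (d + 1) → Fin d → ℝ, AffineIndependent ℝ v ∧
    (∀ i, v i ∈ latticePts d) ∧ Δ = convexHull ℝ (Set.range v)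

/-- `ℤ((P,1) ∩ ℤ^{d+1}) = ℤ^{d+1}`: the lattice points of `P`, with last coordinate `1`
appended, generate all of `ℤ^{d+1}` as a group. -/
def SpansLattice {d : ℕ} (P : Set (Fin d → ℝ)) : Prop :=
  AddSubgroup.closure {y : Fin (d + 1) → ℤ |
    y (Fin.last d) = 1 ∧ (fun i : Fin d => (y i.castSucc : ℝ)) ∈ P} = ⊤

/-- The finite abelian group `Λ_Δ ⊆ (ℝ/ℤ)^{d+1}` attached to a lattice simplex with
ordered vertices `v 0, …, v d`, encoded by its canonical representatives in `[0,1)`. -/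
def simplexLambda {d : ℕ} (v : Fin (d + 1) → Fin d → ℝ) : Set (Fin (d + 1) → ℝ) :=
  {c | (∀ i, 0 ≤ c i ∧ c i < 1) ∧
    (∀ j : Fin d, ∃ z : ℤ, (∑ i, c i * v i j) = (z : ℝ)) ∧
    (∃ z : ℤ, (∑ i, c i) = (z : ℝ))}

/-- The standard basis vector `e_j` of `ℝ^d` (0-indexed). -/
def stdE (d : ℕ) (j : Fin d) : Fin d → ℝ := fun i => if i = j then 1 else 0

/-- The simplex `Δ⁽³⁾ = conv{0, e₁, …, e_{d−1}, w}` with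
`w = 2·Σ_{i=1, i≠d}^{−i₁+2i₂−1} eᵢ + Σ_{i=−i₁+2i₂}^{d−1} eᵢ + 3e_d`
(coordinate `i = j+1` of `w` is `3` if `i = d`, `2` if `i ≤ 2i₂ − i₁ − 1`, and `1` otherwise). -/
def deltaThreeSimplex (d i1 i2 : ℕ) : Set (Fin d → ℝ) :=
  convexHull ℝ
    ({0, fun j : Fin d =>
        if (j : ℕ) = d - 1 then (3 : ℝ)
        else if (j : ℕ) + i1 + 2 ≤ 2 * i2 then 2 else 1} ∪
      {x | ∃ j : Fin d, (j : ℕ) < d - 1 ∧ x = stdE d j})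

/-- The integers as an additive subgroup of `ℝ`. -/
def intSubgroup : AddSubgroup ℝ := (Int.castAddHom ℝ).range

theorem mem_intSubgroup {x : ℝ} : x ∈ intSubgroup ↔ ∃ z : ℤ, x = z :=
  ⟨fun ⟨z, h⟩ => ⟨z, h.symm⟩, fun ⟨z, h⟩ => ⟨z, h.symm⟩⟩

theorem intCast_mem_intSubgroup (z : ℤ) : (z : ℝ) ∈ intSubgroup := ⟨z, rfl⟩

theorem intCast_mul_mem_intSubgroup (z : ℤ) {x : ℝ} (hx : x ∈ intSubgroup) :
    (z : ℝ) * x ∈ intSubgroup := by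
  obtain ⟨y, rfl⟩ := mem_intSubgroup.1 hx
  exact mem_intSubgroup.2 ⟨z * y, by push_cast; rfl⟩

/-- The coefficient vectors `c` for which `∑ cᵢ (vᵢ, 1)` is a lattice point of `ℝ^(d+1)`. -/
def coneLattice {d n : ℕ} (v : Fin n → Fin d → ℝ) : AddSubgroup (Fin n → ℝ) where
  carrier := {c | (∀ j, ∑ i, c i * v i j ∈ intSubgroup) ∧ ∑ i, c i ∈ intSubgroup}
  zero_mem' := by simp [zero_mem]
  add_mem' := by
    rintro a b ⟨ha, ha'⟩ ⟨hb, hb'⟩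
    refine ⟨fun j => ?_, ?_⟩
    · simpa [add_mul, Finset.sum_add_distrib] using add_mem (ha j) (hb j)
    · simpa [Finset.sum_add_distrib] using add_mem ha' hb'
  neg_mem' := by
    rintro a ⟨ha, ha'⟩
    exact ⟨fun j => by simpa using neg_mem (ha j), by simpa using neg_mem ha'⟩

theorem mem_coneLattice {d n : ℕ} {v : Fin n → Fin d → ℝ} {c : Fin n → ℝ} :
    c ∈ coneLattice v ↔
      (∀ j, ∑ i, c i * v i j ∈ intSubgroup) ∧ ∑ i, c i ∈ intSubgroup := Iff.rfl

theorem mem_coneLattice_comp {d n : ℕ} (v : Fin n → Fin d → ℝ) (σ : Equiv.Perm (Fin n))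
    (c : Fin n → ℝ) : c ∈ coneLattice (v ∘ σ) ↔ c ∘ σ.symm ∈ coneLattice v := by
  have h (f : Fin n → ℝ) : ∑ i, c i * f (σ i) = ∑ i, c (σ.symm i) * f i := by
    rw [← Equiv.sum_comp σ fun i => c (σ.symm i) * f i]; simp
  have h' : ∑ i, c i = ∑ i, c (σ.symm i) := (Equiv.sum_comp σ.symm c).symm
  simp only [mem_coneLattice, Function.comp_apply, h', fun j => h (fun i => v i j)]

theorem mem_latticePts {d : ℕ} {x : Fin d → ℝ} :
    x ∈ latticePts d ↔ ∀ i, x i ∈ intSubgroup := by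
  simp [latticePts, mem_intSubgroup]

theorem affineSpan_range_eq_top {d : ℕ} {v : Fin (d + 1) → Fin d → ℝ}
    (hv : AffineIndependent ℝ v) : affineSpan ℝ (Set.range v) = ⊤ := by
  rw [hv.affineSpan_eq_top_iff_card_eq_finrank_add_one]; simp

/-- The vertices of a full-dimensional simplex as an affine basis. -/
def simplexBasis {d : ℕ} {v : Fin (d + 1) → Fin d → ℝ} (hv : AffineIndependent ℝ v) :
    AffineBasis (Fin (d + 1)) ℝ (Fin d → ℝ) :=
  ⟨v, hv, affineSpan_range_eq_top hv⟩

theorem simplexBasis_apply {d : ℕ} {v : Fin (d + 1) → Fin d → ℝ} (hv : AffineIndependent ℝ v)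
    (i : Fin (d + 1)) : simplexBasis hv i = v i := rfl

theorem sum_coord_mul {d : ℕ} {v : Fin (d + 1) → Fin d → ℝ} (hv : AffineIndependent ℝ v)
    (x : Fin d → ℝ) (j : Fin d) : ∑ i, (simplexBasis hv).coord i x * v i j = x j := by
  have := congrFun ((simplexBasis hv).linear_combination_coord_eq_self x) j
  simpa [simplexBasis_apply] using this

theorem coords_mem_coneLattice {d : ℕ} {v : Fin (d + 1) → Fin d → ℝ}
    (hv : AffineIndependent ℝ v) (x : Fin d → ℝ) :
    (simplexBasis hv).coords x ∈ coneLattice v ↔ x ∈ latticePts d := by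
  have h1 : (1 : ℝ) ∈ intSubgroup := by simpa using intCast_mem_intSubgroup 1
  simp [mem_coneLattice, sum_coord_mul, mem_latticePts, h1]

/-- The affine map sending the vertices `v i` of a simplex to the points `w i`. -/
def simplexMap {d e : ℕ} {v : Fin (d + 1) → Fin d → ℝ} (hv : AffineIndependent ℝ v)
    (w : Fin (d + 1) → Fin e → ℝ) : (Fin d → ℝ) →ᵃ[ℝ] (Fin e → ℝ) :=
  (Fintype.linearCombination ℝ w).toAffineMap.comp (simplexBasis hv).coords

theorem simplexMap_apply {d e : ℕ} {v : Fin (d + 1) → Fin d → ℝ} (hv : AffineIndependent ℝ v)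
    (w : Fin (d + 1) → Fin e → ℝ) (x : Fin d → ℝ) :
    simplexMap hv w x = ∑ i, (simplexBasis hv).coord i x • w i := by
  simp [simplexMap, Fintype.linearCombination_apply]

theorem simplexMap_vertex {d e : ℕ} {v : Fin (d + 1) → Fin d → ℝ} (hv : AffineIndependent ℝ v)
    (w : Fin (d + 1) → Fin e → ℝ) (i : Fin (d + 1)) : simplexMap hv w (v i) = w i := by
  have h (k : Fin (d + 1)) : (simplexBasis hv).coord k (v i) = if k = i then 1 else 0 := by
    rw [← simplexBasis_apply hv, AffineBasis.coord_apply]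
  simp [simplexMap_apply, h]

theorem coords_simplexMap {d : ℕ} {v w : Fin (d + 1) → Fin d → ℝ} (hv : AffineIndependent ℝ v)
    (hw : AffineIndependent ℝ w) (x : Fin d → ℝ) :
    (simplexBasis hw).coords (simplexMap hv w x) = (simplexBasis hv).coords x := by
  ext i
  have h1 := (simplexBasis hv).sum_coord_apply_eq_one x
  have h2 := (simplexBasis hw).coord_apply_combination_of_mem (Finset.mem_univ i) h1
  rw [Finset.affineCombination_eq_linear_combination _ _ _ h1] at h2
  rw [AffineBasis.coords_apply, AffineBasis.coords_apply, simplexMap_apply]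
  exact h2

theorem simplexMap_simplexMap {d : ℕ} {v w : Fin (d + 1) → Fin d → ℝ}
    (hv : AffineIndependent ℝ v) (hw : AffineIndependent ℝ w) (x : Fin d → ℝ) :
    simplexMap hw v (simplexMap hv w x) = x := by
  have h (i) := congrFun (coords_simplexMap hv hw x) i
  simp only [AffineBasis.coords_apply] at h
  rw [simplexMap_apply hw]
  simp_rw [h]
  exact (simplexBasis hv).linear_combination_coord_eq_self x

theorem affineSpan_convexHull_range_eq_top {d : ℕ} {v : Fin (d + 1) → Fin d → ℝ}
    (hv : AffineIndependent ℝ v) : affineSpan ℝ (convexHull ℝ (Set.range v)) = ⊤ := by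
  rw [affineSpan_convexHull, affineSpan_range_eq_top hv]

/-- Two simplices with the same cone lattice are unimodularly equivalent. -/
theorem unimodEquiv_of_coneLattice_eq {d : ℕ} {v w : Fin (d + 1) → Fin d → ℝ}
    (hv : AffineIndependent ℝ v) (hw : AffineIndependent ℝ w)
    (h : coneLattice v = coneLattice w) :
    UnimodEquiv (convexHull ℝ (Set.range v)) (convexHull ℝ (Set.range w)) := by
  have key {v w : Fin (d + 1) → Fin d → ℝ} (hv : AffineIndependent ℝ v)
      (hw : AffineIndependent ℝ w) (h : coneLattice v = coneLattice w) :
      Set.MapsTo (simplexMap hv w) (latticePts d) (latticePts d) := fun x hx => by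
    rwa [← coords_mem_coneLattice hw, coords_simplexMap hv hw, ← h, coords_mem_coneLattice hv]
  refine ⟨simplexMap hv w, ?_, ?_⟩
  · rw [affineSpan_convexHull_range_eq_top hv, affineSpan_convexHull_range_eq_top hw]
    simp only [AffineSubspace.top_coe, Set.inter_univ]
    exact Set.InvOn.bijOn (f' := simplexMap hw v)
      ⟨fun x _ => simplexMap_simplexMap hv hw x, fun x _ => simplexMap_simplexMap hw hv x⟩
      (key hv hw h) (key hw hv h.symm)
  · rw [AffineMap.image_convexHull, ← Set.range_comp]
    congr 2
    exact funext (simplexMap_vertex hv w)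

theorem mem_coneLattice_of_int {d n : ℕ} {v : Fin n → Fin d → ℝ} (hv : ∀ i, v i ∈ latticePts d)
    {c : Fin n → ℝ} (hc : ∀ i, c i ∈ intSubgroup) : c ∈ coneLattice v := by
  refine ⟨fun j => sum_mem fun i _ => ?_, sum_mem fun i _ => hc i⟩
  obtain ⟨z, hz⟩ := mem_intSubgroup.1 (hc i)
  rw [hz]
  exact intCast_mul_mem_intSubgroup z (mem_latticePts.1 (hv i) j)

/-- The nonnegative vectors in the cone lattice of height `n`. -/
def heightSlice {d : ℕ} (v : Fin (d + 1) → Fin d → ℝ) (n : ℕ) : Set (Fin (d + 1) → ℝ) :=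
  {c | (∀ i, 0 ≤ c i) ∧ c ∈ coneLattice v ∧ ∑ i, c i = n}

theorem injOn_heightSlice {d : ℕ} {v : Fin (d + 1) → Fin d → ℝ} (hv : AffineIndependent ℝ v)
    (n : ℕ) : Set.InjOn (Fintype.linearCombination ℝ v) (heightSlice v n) := by
  intro a ha b hb hab
  rw [Fintype.linearCombination_apply, Fintype.linearCombination_apply] at hab
  exact funext fun i =>
    hv.eq_of_sum_eq_sum (ha.2.2.trans hb.2.2.symm) hab i (Finset.mem_univ i)

theorem convexHull_range_eq_image_stdSimplex {d n : ℕ} (v : Fin n → Fin d → ℝ) :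
    convexHull ℝ (Set.range v) = Fintype.linearCombination ℝ v '' stdSimplex ℝ (Fin n) := by
  rw [← convexHull_rangle_single_eq_stdSimplex, LinearMap.image_convexHull, ← Set.range_comp]
  congr 2
  ext i : 1
  simp

theorem image_heightSlice {d : ℕ} (v : Fin (d + 1) → Fin d → ℝ) (n : ℕ) :
    Fintype.linearCombination ℝ v '' heightSlice v n =
      latticePts d ∩ (n : ℝ) • convexHull ℝ (Set.range v) := by
  rw [convexHull_range_eq_image_stdSimplex]
  ext x
  constructor
  · rintro ⟨c, ⟨h0, hL, hs⟩, rfl⟩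
    refine ⟨mem_latticePts.2 fun j => by simpa [Fintype.linearCombination_apply] using hL.1 j, ?_⟩
    rw [Set.mem_smul_set]
    rcases Nat.eq_zero_or_pos n with rfl | hn
    · have hc : c = 0 := by
        ext i
        exact (Finset.sum_eq_zero_iff_of_nonneg fun i _ => h0 i).1 (by simpa using hs) i
          (Finset.mem_univ i)
      exact ⟨_, ⟨Pi.single 0 1, single_mem_stdSimplex ℝ 0, rfl⟩, by simp [hc]⟩
    · have hn' : (n : ℝ) ≠ 0 := by positivity
      refine ⟨_, ⟨(n : ℝ)⁻¹ • c, ⟨fun i => ?_, ?_⟩, rfl⟩, ?_⟩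
      · exact mul_nonneg (by positivity) (h0 i)
      · simp [← Finset.mul_sum, hs, hn']
      · rw [map_smul, smul_inv_smul₀ hn']
  · rintro ⟨hx, hx'⟩
    rw [Set.mem_smul_set] at hx'
    obtain ⟨_, ⟨c, ⟨h0, h1⟩, rfl⟩, rfl⟩ := hx'
    refine ⟨(n : ℝ) • c, ⟨fun i => mul_nonneg (by positivity) (h0 i), ⟨fun j => ?_, ?_⟩, ?_⟩,
      map_smul _ _ _⟩
    · rw [← map_smul, mem_latticePts] at hx
      simpa [Fintype.linearCombination_apply, Finset.mul_sum, mul_assoc] using hx j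
    · simpa [← Finset.mul_sum, h1] using intCast_mem_intSubgroup n
    · simp [← Finset.mul_sum, h1]

theorem ehrhartCount_eq_ncard_heightSlice {d : ℕ} {v : Fin (d + 1) → Fin d → ℝ}
    (hv : AffineIndependent ℝ v) (n : ℕ) :
    ehrhartCount (convexHull ℝ (Set.range v)) n = (heightSlice v n).ncard := by
  rw [ehrhartCount, ← image_heightSlice, (injOn_heightSlice hv n).ncard_image]

theorem finite_heightSlice {d : ℕ} {v : Fin (d + 1) → Fin d → ℝ}
    (hv : AffineIndependent ℝ v) (n : ℕ) : (heightSlice v n).Finite := by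
  refine Set.Finite.of_finite_image ?_ (injOn_heightSlice hv n)
  let B : Fin d → ℤ := fun j => ⌈∑ i, (n : ℝ) * |v i j|⌉
  refine ((Set.finite_Icc (-B) B).image fun z j => ((z j : ℤ) : ℝ)).subset ?_
  rintro _ ⟨c, ⟨h0, hL, hs⟩, rfl⟩
  have hle (i) : c i ≤ n := hs ▸ Finset.single_le_sum (fun i _ => h0 i) (Finset.mem_univ i)
  choose z hz using fun j => mem_intSubgroup.1 (hL.1 j)
  have hB (j) : |z j| ≤ B j := by
    have h1 : |(z j : ℝ)| ≤ ∑ i, (n : ℝ) * |v i j| := by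
      rw [← hz]
      refine (Finset.abs_sum_le_sum_abs _ _).trans (Finset.sum_le_sum fun i _ => ?_)
      rw [abs_mul, abs_of_nonneg (h0 i)]
      gcongr
      exact hle i
    have h2 : ((|z j| : ℤ) : ℝ) ≤ B j := by push_cast; exact h1.trans (Int.le_ceil _)
    exact_mod_cast h2
  refine ⟨z, ⟨fun j => (abs_le.1 (hB j)).1, fun j => (abs_le.1 (hB j)).2⟩, ?_⟩
  ext j
  simp [Fintype.linearCombination_apply, ← hz]

theorem mem_simplexLambda {d : ℕ} {v : Fin (d + 1) → Fin d → ℝ} {c : Fin (d + 1) → ℝ} :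
    c ∈ simplexLambda v ↔ (∀ i, 0 ≤ c i ∧ c i < 1) ∧ c ∈ coneLattice v := by
  simp [simplexLambda, mem_coneLattice, mem_intSubgroup]

/-- The height `∑ cᵢ` of an element of `simplexLambda`, as a natural number. -/
def lambdaHeight {d : ℕ} (c : Fin (d + 1) → ℝ) : ℕ := ⌊∑ i, c i⌋₊

theorem lambdaHeight_cast {d : ℕ} {v : Fin (d + 1) → Fin d → ℝ} {c : Fin (d + 1) → ℝ}
    (hc : c ∈ simplexLambda v) : (lambdaHeight c : ℝ) = ∑ i, c i := by
  rw [mem_simplexLambda] at hc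
  obtain ⟨z, hz⟩ := mem_intSubgroup.1 hc.2.2
  have h0 : (0 : ℝ) ≤ z := hz ▸ Finset.sum_nonneg fun i _ => (hc.1 i).1
  lift z to ℕ using (by exact_mod_cast h0)
  simp [lambdaHeight, hz]

theorem finite_simplexLambda {d : ℕ} {v : Fin (d + 1) → Fin d → ℝ}
    (hv : AffineIndependent ℝ v) : (simplexLambda v).Finite := by
  refine ((Finset.range (d + 2)).finite_toSet.biUnion fun n _ => finite_heightSlice hv n).subset ?_
  intro c hc
  have hs := lambdaHeight_cast hc
  rw [mem_simplexLambda] at hc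
  have hle : ∑ i, c i ≤ ∑ i : Fin (d + 1), (1 : ℝ) :=
    Finset.sum_le_sum fun i _ => (hc.1 i).2.le
  simp only [Set.mem_iUnion]
  refine ⟨lambdaHeight c, ?_, fun i => (hc.1 i).1, hc.2, hs.symm⟩
  rw [← hs] at hle
  simp only [Finset.sum_const, Finset.card_univ, Fintype.card_fin, nsmul_eq_mul, mul_one] at hle
  have : lambdaHeight c ≤ d + 1 := by exact_mod_cast hle
  simp only [Finset.coe_range, Set.mem_Iio]
  omega

theorem fract_mem_simplexLambda {d : ℕ} {v : Fin (d + 1) → Fin d → ℝ}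
    (hv : ∀ i, v i ∈ latticePts d) {c : Fin (d + 1) → ℝ} (hc : c ∈ coneLattice v) :
    (fun i => Int.fract (c i)) ∈ simplexLambda v := by
  refine mem_simplexLambda.2 ⟨fun i => ⟨Int.fract_nonneg _, Int.fract_lt_one _⟩, ?_⟩
  exact sub_mem hc (mem_coneLattice_of_int hv fun i => intCast_mem_intSubgroup ⌊c i⌋)

open Classical in
theorem card_fiber_heightSlice {d : ℕ} {v : Fin (d + 1) → Fin d → ℝ}
    (hv : AffineIndependent ℝ v) (hvl : ∀ i, v i ∈ latticePts d) (n : ℕ)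
    {l : Fin (d + 1) → ℝ} (hl : l ∈ simplexLambda v) :
    ((finite_heightSlice hv n).toFinset.filter fun c => (fun i => Int.fract (c i)) = l).card =
      if lambdaHeight l ≤ n then
        (Finset.finsuppAntidiag (Finset.univ : Finset (Fin (d + 1))) (n - lambdaHeight l)).card
      else 0 := by
  have hs := lambdaHeight_cast hl
  have hl' := mem_simplexLambda.1 hl
  split_ifs with h
  · refine Finset.card_nbij' (fun c => Finsupp.equivFunOnFinite.symm fun i => ⌊c i⌋₊)
      (fun m i => l i + m i) ?_ ?_ ?_ ?_
    · intro c hc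
      simp only [Finset.coe_filter, Set.Finite.mem_toFinset, Set.mem_ofPred_eq] at hc
      obtain ⟨⟨h0, -, hsum⟩, rfl⟩ := hc
      simp only [Finset.mem_coe, Finset.mem_finsuppAntidiag, Finset.subset_univ, and_true]
      have : ((∑ i, ⌊c i⌋₊ : ℕ) : ℝ) = n - lambdaHeight fun i => Int.fract (c i) := by
        rw [hs, ← hsum, ← Finset.sum_sub_distrib]
        push_cast
        refine Finset.sum_congr rfl fun i _ => ?_
        rw [natCast_floor_eq_intCast_floor (h0 i), Int.self_sub_fract]
      rw [← Nat.cast_sub h] at this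
      exact_mod_cast this
    · intro m hm
      simp only [Finset.mem_coe, Finset.mem_finsuppAntidiag, Finset.subset_univ, and_true] at hm
      simp only [Finset.coe_filter, Set.Finite.mem_toFinset, Set.mem_ofPred_eq]
      refine ⟨⟨fun i => add_nonneg (hl'.1 i).1 (by positivity), ?_, ?_⟩, ?_⟩
      · exact add_mem hl'.2 (mem_coneLattice_of_int hvl fun i => intCast_mem_intSubgroup (m i))
      · rw [Finset.sum_add_distrib, ← hs, ← Nat.cast_sum, hm, ← Nat.cast_add]
        congr 1
        omega
      · ext i
        rw [Int.fract_add_natCast, Int.fract_eq_self.2 (hl'.1 i)]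
    · intro c hc
      simp only [Finset.coe_filter, Set.Finite.mem_toFinset, Set.mem_ofPred_eq] at hc
      obtain ⟨⟨h0, -, hsum⟩, rfl⟩ := hc
      ext i
      simp [natCast_floor_eq_intCast_floor (h0 i)]
    · intro m hm
      ext i
      simp only [Finsupp.equivFunOnFinite_symm_apply_apply]
      rw [Nat.floor_add_natCast (hl'.1 i).1, Nat.floor_eq_zero.2 (hl'.1 i).2, zero_add]
  · rw [Finset.card_eq_zero, Finset.filter_eq_empty_iff]
    rintro c hc rfl
    obtain ⟨h0, -, hsum⟩ := (Set.Finite.mem_toFinset _).1 hc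
    refine h ?_
    have : (lambdaHeight fun i => Int.fract (c i) : ℝ) ≤ n := by
      rw [hs, ← hsum]
      refine Finset.sum_le_sum fun i _ => ?_
      have : (0 : ℝ) ≤ ⌊c i⌋ := by exact_mod_cast Int.floor_nonneg.2 (h0 i)
      have := Int.self_sub_floor (c i)
      linarith
    exact_mod_cast this

open Classical in
theorem ncard_heightSlice {d : ℕ} {v : Fin (d + 1) → Fin d → ℝ}
    (hv : AffineIndependent ℝ v) (hvl : ∀ i, v i ∈ latticePts d) (n : ℕ) :
    (heightSlice v n).ncard = ∑ l ∈ (finite_simplexLambda hv).toFinset,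
      if lambdaHeight l ≤ n then
        (Finset.finsuppAntidiag (Finset.univ : Finset (Fin (d + 1))) (n - lambdaHeight l)).card
      else 0 := by
  rw [Set.ncard_eq_toFinset_card _ (finite_heightSlice hv n),
    Finset.card_eq_sum_card_fiberwise (f := fun c i => Int.fract (c i))
      (t := (finite_simplexLambda hv).toFinset)]
  · refine Finset.sum_congr rfl fun l hl => ?_
    exact card_fiber_heightSlice hv hvl n ((Set.Finite.mem_toFinset _).1 hl)
  · intro c hc
    simp only [Set.Finite.coe_toFinset] at hc ⊢
    exact fract_mem_simplexLambda hvl hc.2.1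

theorem ehrhartSeries_eq {d : ℕ} {v : Fin (d + 1) → Fin d → ℝ}
    (hv : AffineIndependent ℝ v) (hvl : ∀ i, v i ∈ latticePts d) :
    ehrhartSeries (convexHull ℝ (Set.range v)) =
      (∑ l ∈ (finite_simplexLambda hv).toFinset, PowerSeries.X ^ lambdaHeight l) *
        (PowerSeries.mk 1 : PowerSeries ℤ) ^ (d + 1) := by
  have hmk (k : ℕ) : PowerSeries.coeff k ((PowerSeries.mk 1 : PowerSeries ℤ) ^ (d + 1)) =
      (Finset.finsuppAntidiag (Finset.univ : Finset (Fin (d + 1))) k).card := by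
    have : (PowerSeries.mk 1 : PowerSeries ℤ) ^ (d + 1) =
      ∏ _i : Fin (d + 1), (PowerSeries.mk 1 : PowerSeries ℤ) := by simp
    rw [this, PowerSeries.coeff_prod]
    simp
  have h0 : (heightSlice v 0).ncard = 1 := by
    rw [Set.ncard_eq_one]
    refine ⟨0, Set.eq_singleton_iff_unique_mem.2 ⟨⟨by simp, zero_mem _, by simp⟩, ?_⟩⟩
    rintro c ⟨hc, -, hs⟩
    ext i
    exact (Finset.sum_eq_zero_iff_of_nonneg fun i _ => hc i).1 (by simpa using hs) i
      (Finset.mem_univ i)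
  have hE (n : ℕ) : PowerSeries.coeff n (ehrhartSeries (convexHull ℝ (Set.range v))) =
      (heightSlice v n).ncard := by
    rw [ehrhartSeries, PowerSeries.coeff_mk]
    split_ifs with h
    · subst h; simp [h0]
    · rw [ehrhartCount_eq_ncard_heightSlice hv]
  ext n
  rw [hE, ncard_heightSlice hv hvl, Finset.sum_mul, map_sum]
  push_cast
  refine Finset.sum_congr rfl fun l _ => ?_
  rw [PowerSeries.coeff_X_pow_mul', hmk]

/-- The `δ`-polynomial of a lattice simplex is the height enumerator of `simplexLambda`. -/
theorem HasDeltaPoly.eq_sum_X_pow {d : ℕ} {v : Fin (d + 1) → Fin d → ℝ}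
    (hv : AffineIndependent ℝ v) (hvl : ∀ i, v i ∈ latticePts d) {p : ℤ[X]}
    (hp : HasDeltaPoly (convexHull ℝ (Set.range v)) p) :
    p = ∑ l ∈ (finite_simplexLambda hv).toFinset, X ^ lambdaHeight l := by
  rw [HasDeltaPoly, ehrhartSeries_eq hv hvl, mul_comm, mul_assoc, ← mul_pow,
    PowerSeries.mk_one_mul_one_sub_eq_one, one_pow, mul_one] at hp
  apply Polynomial.coe_injective
  rw [← hp, ← Polynomial.coeToPowerSeries.ringHom_apply, map_sum]
  simp

/-- Integer vectors inside `ℝ^n`. -/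
def intVectors (n : ℕ) : AddSubgroup (Fin n → ℝ) := AddSubgroup.pi Set.univ fun _ => intSubgroup

theorem mem_intVectors {n : ℕ} {c : Fin n → ℝ} : c ∈ intVectors n ↔ ∀ i, c i ∈ intSubgroup := by
  simp [intVectors, AddSubgroup.mem_pi]

/-- The lattice generated by `m / 3` and the integer vectors. -/
def thirdLattice {n : ℕ} (m : Fin n → ℤ) : Set (Fin n → ℝ) :=
  {c | ∃ k : ℤ, ∀ i, c i - k * (m i / 3) ∈ intSubgroup}

theorem card_quotient_coneLattice {d : ℕ} {v : Fin (d + 1) → Fin d → ℝ}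
    (hv : ∀ i, v i ∈ latticePts d) :
    Nat.card (coneLattice v ⧸ (intVectors (d + 1)).addSubgroupOf (coneLattice v)) =
      Nat.card (simplexLambda v) := by
  symm
  refine Nat.card_congr (Equiv.ofBijective
    (fun l => QuotientAddGroup.mk ⟨l.1, (mem_simplexLambda.1 l.2).2⟩) ⟨?_, ?_⟩)
  · rintro ⟨a, ha⟩ ⟨b, hb⟩ hab
    have h := QuotientAddGroup.eq.1 hab
    rw [AddSubgroup.mem_addSubgroupOf, mem_intVectors] at h
    rw [mem_simplexLambda] at ha hb
    ext i
    obtain ⟨z, hz⟩ := mem_intSubgroup.1 (h i)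
    have hz' : b i = a i + z := by
      rw [← hz]
      simp
    have := congrArg Int.fract hz'
    rwa [Int.fract_add_intCast, Int.fract_eq_self.2 (hb.1 i), Int.fract_eq_self.2 (ha.1 i),
      eq_comm] at this
  · intro q
    obtain ⟨⟨c, hc⟩, rfl⟩ := QuotientAddGroup.mk_surjective q
    refine ⟨⟨_, fract_mem_simplexLambda hv hc⟩, QuotientAddGroup.eq.2 ?_⟩
    rw [AddSubgroup.mem_addSubgroupOf, mem_intVectors]
    intro i
    have : -Int.fract (c i) + c i ∈ intSubgroup := by
      rw [neg_add_eq_sub, Int.self_sub_fract]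
      exact intCast_mem_intSubgroup _
    exact this

theorem exists_generator_of_card_eq_three {d : ℕ} {v : Fin (d + 1) → Fin d → ℝ}
    (hv : ∀ i, v i ∈ latticePts d) (hcard : Nat.card (simplexLambda v) = 3)
    {g : Fin (d + 1) → ℝ} (hg : g ∈ simplexLambda v) (hg0 : g ≠ 0) :
    ∃ m : Fin (d + 1) → ℤ, (∀ i, g i = m i / 3) ∧ (∀ i, 0 ≤ m i ∧ m i ≤ 2) ∧
      ∀ c, c ∈ coneLattice v ↔ c ∈ thirdLattice m := by
  rw [← card_quotient_coneLattice hv] at hcard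
  have : Fact (Nat.Prime 3) := ⟨Nat.prime_three⟩
  have hgl := mem_simplexLambda.1 hg
  let q : coneLattice v ⧸ (intVectors (d + 1)).addSubgroupOf (coneLattice v) :=
    QuotientAddGroup.mk ⟨g, hgl.2⟩
  have hq0 : q ≠ 0 := by
    intro h
    rw [QuotientAddGroup.eq_zero_iff, AddSubgroup.mem_addSubgroupOf, mem_intVectors] at h
    refine hg0 (funext fun i => ?_)
    obtain ⟨z, hz⟩ := mem_intSubgroup.1 (h i)
    rw [← Int.fract_eq_self.2 (hgl.1 i)]
    change g i = z at hz
    simp [hz]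
  have h3 : (3 : ℕ) • q = 0 := hcard ▸ card_nsmul_eq_zero'
  have h3' : (3 : ℕ) • g ∈ intVectors (d + 1) := by
    rw [← QuotientAddGroup.mk_nsmul, QuotientAddGroup.eq_zero_iff,
      AddSubgroup.mem_addSubgroupOf] at h3
    exact h3
  choose m hm using fun i => mem_intSubgroup.1 (mem_intVectors.1 h3' i)
  have hgm (i) : g i = m i / 3 := by
    rw [← hm i]
    simp
  refine ⟨m, hgm, fun i => ?_, fun c => ⟨fun hc => ?_, ?_⟩⟩
  · have h := hgl.1 i
    rw [hgm] at h
    have h1 : (0 : ℝ) ≤ m i := by linarith [h.1]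
    have h2 : (m i : ℝ) < 3 := by linarith [h.2]
    have h1' : 0 ≤ m i := by exact_mod_cast h1
    have h2' : m i < 3 := by exact_mod_cast h2
    omega
  · obtain ⟨k, hk⟩ := AddSubgroup.mem_zmultiples_iff.1
      (mem_zmultiples_of_prime_card hcard hq0 (g' := QuotientAddGroup.mk ⟨c, hc⟩))
    rw [← QuotientAddGroup.mk_zsmul, QuotientAddGroup.eq, AddSubgroup.mem_addSubgroupOf,
      mem_intVectors] at hk
    refine ⟨k, fun i => ?_⟩
    have : c i - k * (m i / 3) = -(k • g i) + c i := by rw [← hgm, zsmul_eq_mul]; ring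
    exact this ▸ hk i
  · rintro ⟨k, hk⟩
    have h1 : k • g ∈ coneLattice v := zsmul_mem hgl.2 k
    have h2 : (fun i => c i - k * (m i / 3)) ∈ coneLattice v := mem_coneLattice_of_int hv hk
    convert add_mem h2 h1 using 1
    ext i
    simp [hgm]

theorem exists_generator_of_hasDeltaPoly {d i1 i2 : ℕ} (hi1 : 1 ≤ i1)
    {v : Fin (d + 1) → Fin d → ℝ} (hv : AffineIndependent ℝ v) (hvl : ∀ i, v i ∈ latticePts d)
    (hδ : HasDeltaPoly (convexHull ℝ (Set.range v)) (1 + X ^ i1 + X ^ i2)) :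
    ∃ m : Fin (d + 1) → ℤ, (∀ i, 0 ≤ m i ∧ m i ≤ 2) ∧ ∑ i, m i = 3 * i1 ∧
      (∀ c, c ∈ coneLattice v ↔ c ∈ thirdLattice m) ∧ ((∀ i, m i ≠ 0) → i1 + i2 = d + 1) := by
  have hp := hδ.eq_sum_X_pow hv hvl
  have hcard : (finite_simplexLambda hv).toFinset.card = 3 := by
    have := congrArg (Polynomial.eval 1) hp
    simp only [eval_add, eval_one, eval_pow, eval_X, one_pow, eval_finsetSum, Finset.sum_const,
      nsmul_eq_mul, mul_one] at this
    zify
    linarith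
  obtain ⟨g, hg, hgh⟩ : ∃ g ∈ simplexLambda v, lambdaHeight g = i1 := by
    by_contra! h
    have hc := congrArg (Polynomial.coeff · i1) hp
    simp only [coeff_add, coeff_one, coeff_X_pow, finsetSum_coeff] at hc
    rw [Finset.sum_eq_zero fun l hl => if_neg (h l ((Set.Finite.mem_toFinset _).1 hl)).symm] at hc
    split_ifs at hc <;> omega
  have hgs := lambdaHeight_cast hg
  have hg0 : g ≠ 0 := by
    rintro rfl
    simp only [Pi.zero_apply, Finset.sum_const_zero, Nat.cast_eq_zero] at hgs
    omega
  have hncard : Nat.card (simplexLambda v) = 3 := by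
    rw [Nat.card_coe_set_eq, Set.ncard_eq_toFinset_card _ (finite_simplexLambda hv), hcard]
  obtain ⟨m, hgm, hm, hL⟩ := exists_generator_of_card_eq_three hvl hncard hg hg0
  have hms : ∑ i, m i = 3 * i1 := by
    rw [hgh] at hgs
    simp only [hgm, ← Finset.sum_div] at hgs
    have : ((∑ i, m i : ℤ) : ℝ) = ((3 * i1 : ℤ) : ℝ) := by
      push_cast
      linarith
    exact_mod_cast this
  refine ⟨m, hm, hms, hL, fun hm0 => ?_⟩
  have hg1 (i) : 0 < g i ∧ g i < 1 ∧ 1 - g i ≠ g i := by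
    have := hm i
    have := hm0 i
    rw [hgm]
    obtain h | h : m i = 1 ∨ m i = 2 := by omega
    all_goals rw [h]; norm_num
  let g' : Fin (d + 1) → ℝ := fun i => 1 - g i
  have hg' : g' ∈ simplexLambda v := by
    refine mem_simplexLambda.2 ⟨fun i => ?_, ?_⟩
    · have := hg1 i
      constructor <;> simp only [g'] <;> linarith
    · exact sub_mem (mem_coneLattice_of_int (c := fun _ => 1) hvl fun i =>
        by simpa using intCast_mem_intSubgroup 1) (mem_simplexLambda.1 hg).2
  have h0 : (0 : Fin (d + 1) → ℝ) ∈ simplexLambda v :=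
    mem_simplexLambda.2 ⟨by simp, zero_mem _⟩
  have hg'g : g' ≠ g := fun h => (hg1 0).2.2 (congrFun h 0)
  have hg'0 : g' ≠ 0 := fun h => by
    have h1 : 1 - g 0 = 0 := congrFun h 0
    linarith [(hg1 0).2.1]
  have hF : (finite_simplexLambda hv).toFinset = {0, g, g'} := by
    symm
    refine Finset.eq_of_subset_of_card_le ?_ ?_
    · intro x hx
      simp only [Finset.mem_insert, Finset.mem_singleton] at hx
      rw [Set.Finite.mem_toFinset]
      rcases hx with rfl | rfl | rfl <;> assumption
    · rw [hcard, Finset.card_eq_three.2 ⟨0, g, g', hg0.symm, hg'0.symm, hg'g.symm, rfl⟩]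
  have hd := congrArg (fun p => Polynomial.eval 1 (Polynomial.derivative p)) hp
  rw [hF, Finset.sum_insert (by simp [hg0.symm, hg'0.symm]),
    Finset.sum_insert (by simp [hg'g.symm]), Finset.sum_singleton] at hd
  simp only [derivative_add, derivative_one, derivative_X_pow, eval_add, eval_mul, eval_pow,
    eval_X, one_pow, mul_one, eval_natCast, zero_add, map_natCast] at hd
  have hh0 : lambdaHeight (0 : Fin (d + 1) → ℝ) = 0 := by simp [lambdaHeight]
  have hs' := lambdaHeight_cast hg'
  simp only [g', Finset.sum_sub_distrib, ← hgs] at hs'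
  simp only [Finset.sum_const, Finset.card_univ, Fintype.card_fin, nsmul_eq_mul, mul_one] at hs'
  have hs'' : (lambdaHeight g' : ℤ) + lambdaHeight g = d + 1 := by
    have : (lambdaHeight g' : ℝ) + lambdaHeight g = d + 1 := by
      rw [hs']; push_cast; ring
    exact_mod_cast this
  rw [hh0] at hd
  push_cast at hd
  omega

theorem thirdLattice_neg {n : ℕ} (m : Fin n → ℤ) : thirdLattice (-m) = thirdLattice m := by
  have h (m : Fin n → ℤ) : thirdLattice m ⊆ thirdLattice (-m) := by
    rintro c ⟨k, hk⟩
    refine ⟨-k, fun i => ?_⟩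
    convert hk i using 1
    push_cast [Pi.neg_apply]
    ring
  exact Set.Subset.antisymm (by simpa using h (-m)) (h m)

theorem mem_thirdLattice_comp {n : ℕ} (m : Fin n → ℤ) (σ : Equiv.Perm (Fin n)) (c : Fin n → ℝ) :
    c ∈ thirdLattice (m ∘ σ) ↔ c ∘ σ.symm ∈ thirdLattice m :=
  exists_congr fun k => ⟨fun h i => by simpa using h (σ.symm i), fun h i => by simpa using h (σ i)⟩

theorem mem_coneLattice_comp_iff {d n : ℕ} {v : Fin n → Fin d → ℝ} {m : Fin n → ℤ}
    (h : ∀ c, c ∈ coneLattice v ↔ c ∈ thirdLattice m) (σ : Equiv.Perm (Fin n)) (c : Fin n → ℝ) :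
    c ∈ coneLattice (v ∘ σ) ↔ c ∈ thirdLattice (m ∘ σ) := by
  rw [mem_coneLattice_comp, mem_thirdLattice_comp, h]

theorem affineIndependent_of_forall_sum_eq_zero {d n : ℕ} {v : Fin n → Fin d → ℝ}
    (h : ∀ c : Fin n → ℝ, ∑ i, c i = 0 → (∀ j, ∑ i, c i * v i j = 0) → ∀ i, c i = 0) :
    AffineIndependent ℝ v := by
  rw [affineIndependent_iff_of_fintype]
  intro w hw hwv
  rw [Finset.weightedVSub_eq_linear_combination _ hw] at hwv
  exact h w hw fun j => by simpa using congrFun hwv j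

/-- The vertices of the simplex `conv{0, e₁, …, e_k, a} ⊆ ℝ^(k+1)`. -/
def normalFormVertex {k : ℕ} (a : Fin (k + 1) → ℤ) : Fin (k + 2) → Fin (k + 1) → ℝ :=
  Fin.cons 0 fun i => if i = Fin.last k then fun j => (a j : ℝ) else stdE (k + 1) i

theorem normalFormVertex_zero {k : ℕ} (a : Fin (k + 1) → ℤ) : normalFormVertex a 0 = 0 := rfl

theorem normalFormVertex_castSucc_succ {k : ℕ} (a : Fin (k + 1) → ℤ) (i : Fin k) :
    normalFormVertex a i.castSucc.succ = stdE (k + 1) i.castSucc := by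
  simp [normalFormVertex, (Fin.castSucc_lt_last _).ne]

theorem normalFormVertex_last {k : ℕ} (a : Fin (k + 1) → ℤ) :
    normalFormVertex a (Fin.last (k + 1)) = fun j => (a j : ℝ) := by
  rw [← Fin.succ_last]
  simp [normalFormVertex]

theorem sum_mul_normalFormVertex {k : ℕ} (a : Fin (k + 1) → ℤ) (c : Fin (k + 2) → ℝ)
    (j : Fin (k + 1)) : ∑ i, c i * normalFormVertex a i j =
      (if j = Fin.last k then 0 else c j.succ) + c (Fin.last (k + 1)) * a j := by
  rw [Fin.sum_univ_succ, Fin.sum_univ_castSucc]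
  simp only [Fin.succ_last, Nat.succ_eq_add_one, normalFormVertex_zero, normalFormVertex_last,
    normalFormVertex_castSucc_succ, Pi.zero_apply, mul_zero, zero_add, stdE]
  congr 1
  refine Fin.lastCases ?_ (fun j => ?_) j
  · simp [(Fin.castSucc_lt_last _).ne']
  · simp [(Fin.castSucc_lt_last _).ne, Fin.castSucc_inj]

theorem affineIndependent_normalFormVertex {k : ℕ} {a : Fin (k + 1) → ℤ}
    (ha : a (Fin.last k) = 3) : AffineIndependent ℝ (normalFormVertex a) := by
  refine affineIndependent_of_forall_sum_eq_zero fun c hc hcv => ?_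
  simp only [sum_mul_normalFormVertex] at hcv
  have hlast : c (Fin.last (k + 1)) = 0 := by simpa [ha] using hcv (Fin.last k)
  have hsucc (j : Fin (k + 1)) : c j.succ = 0 := by
    refine Fin.lastCases hlast (fun j => ?_) j
    simpa [(Fin.castSucc_lt_last _).ne, hlast] using hcv j.castSucc
  refine Fin.cases ?_ hsucc
  rwa [Fin.sum_univ_succ, Finset.sum_eq_zero fun j _ => hsucc j, add_zero] at hc

theorem normalFormVertex_mem_latticePts {k : ℕ} (a : Fin (k + 1) → ℤ) (i : Fin (k + 2)) :
    normalFormVertex a i ∈ latticePts (k + 1) := by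
  refine Fin.cases ?_ (fun i => ?_) i
  · exact mem_latticePts.2 fun j => zero_mem _
  · simp only [mem_latticePts, normalFormVertex, Fin.cons_succ]
    intro j
    split_ifs
    · exact intCast_mem_intSubgroup _
    · rw [stdE]
      split_ifs
      · simpa using intCast_mem_intSubgroup 1
      · exact zero_mem _

theorem mem_coneLattice_normalFormVertex {k : ℕ} {a : Fin (k + 1) → ℤ}
    (ha : a (Fin.last k) = 3) {m : Fin (k + 2) → ℤ} (hm : 3 ∣ m (Fin.last (k + 1)) - 1)
    (hma : ∀ i : Fin k, 3 ∣ m i.castSucc.succ + a i.castSucc) (hms : 3 ∣ ∑ i, m i)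
    (c : Fin (k + 2) → ℝ) : c ∈ coneLattice (normalFormVertex a) ↔ c ∈ thirdLattice m := by
  obtain ⟨s, hs⟩ := hms
  have hsR : ∑ i, (m i : ℝ) = 3 * s := by exact_mod_cast hs
  obtain ⟨z, hz⟩ := hm
  have hzR : (m (Fin.last (k + 1)) : ℝ) = 1 + 3 * z := by
    have : m (Fin.last (k + 1)) = 1 + 3 * z := by omega
    exact_mod_cast this
  choose y hy using hma
  have hyR (i : Fin k) : (m i.castSucc.succ : ℝ) = 3 * y i - a i.castSucc := by
    rw [eq_sub_iff_add_eq]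
    exact_mod_cast hy i
  constructor
  · rintro ⟨hc, hcs⟩
    simp only [sum_mul_normalFormVertex] at hc
    obtain ⟨t, ht⟩ := mem_intSubgroup.1 (hc (Fin.last k))
    simp only [if_true, ha, zero_add] at ht
    have hlast : c (Fin.last (k + 1)) = t / 3 := by
      push_cast at ht
      linarith
    have hsucc (j : Fin (k + 1)) : c j.succ - t * (m j.succ / 3) ∈ intSubgroup := by
      refine Fin.lastCases ?_ (fun j => ?_) j
      · rw [Fin.succ_last, hlast, hzR]
        exact mem_intSubgroup.2 ⟨-(t * z), by push_cast; ring⟩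
      · have h := hc j.castSucc
        rw [if_neg (Fin.castSucc_lt_last _).ne, hlast] at h
        obtain ⟨x, hx⟩ := mem_intSubgroup.1 h
        rw [hyR]
        refine mem_intSubgroup.2 ⟨x - t * y j, ?_⟩
        push_cast
        rw [← hx]
        ring
    refine ⟨t, Fin.cases ?_ hsucc⟩
    have hsum : ∑ i, (c i - t * (m i / 3)) ∈ intSubgroup := by
      rw [Finset.sum_sub_distrib, ← Finset.mul_sum, ← Finset.sum_div, hsR,
        mul_div_cancel_left₀ _ (by norm_num)]
      exact sub_mem hcs (intCast_mul_mem_intSubgroup t (intCast_mem_intSubgroup s))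
    rw [Fin.sum_univ_succ] at hsum
    exact (intSubgroup.add_mem_cancel_right (sum_mem fun j _ => hsucc j)).1 hsum
  · rintro ⟨t, ht⟩
    have h1 : (fun i => (m i : ℝ) / 3) ∈ coneLattice (normalFormVertex a) := by
      refine ⟨fun j => ?_, ?_⟩
      · rw [sum_mul_normalFormVertex]
        refine Fin.lastCases ?_ (fun j => ?_) j
        · refine mem_intSubgroup.2 ⟨m (Fin.last (k + 1)), ?_⟩
          simp only [if_true, ha]
          push_cast
          ring
        · refine mem_intSubgroup.2 ⟨y j + z * a j.castSucc, ?_⟩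
          rw [if_neg (Fin.castSucc_lt_last _).ne, hyR, hzR]
          push_cast
          ring
      · rw [← Finset.sum_div, hsR]
        exact mem_intSubgroup.2 ⟨s, by ring⟩
    have h2 := mem_coneLattice_of_int (normalFormVertex_mem_latticePts a) ht
    convert add_mem h2 (zsmul_mem h1 t) using 1
    ext i
    simp

/-- The vertices of the lattice pyramid over the simplex with vertices `q`. -/
def pyramidVertex {n e : ℕ} (q : Fin n → Fin e → ℝ) : Fin (n + 1) → Fin (e + 1) → ℝ :=
  Fin.snoc (α := fun _ => Fin (e + 1) → ℝ)
    (fun i => Fin.snoc (α := fun _ => ℝ) (q i) 0) (Fin.snoc (α := fun _ => ℝ) 0 1)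

theorem sum_mul_pyramidVertex_castSucc {n e : ℕ} (q : Fin n → Fin e → ℝ) (c : Fin (n + 1) → ℝ)
    (j : Fin e) : ∑ i, c i * pyramidVertex q i j.castSucc = ∑ i, c (Fin.castSucc i) * q i j := by
  simp [Fin.sum_univ_castSucc, pyramidVertex]

theorem sum_mul_pyramidVertex_last {n e : ℕ} (q : Fin n → Fin e → ℝ) (c : Fin (n + 1) → ℝ) :
    ∑ i, c i * pyramidVertex q i (Fin.last e) = c (Fin.last n) := by
  simp [Fin.sum_univ_castSucc, pyramidVertex]

theorem affineIndependent_pyramidVertex {n e : ℕ} {q : Fin n → Fin e → ℝ}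
    (hq : AffineIndependent ℝ q) : AffineIndependent ℝ (pyramidVertex q) := by
  refine affineIndependent_of_forall_sum_eq_zero fun c hc hcv => ?_
  have hlast : c (Fin.last n) = 0 := by
    simpa only [sum_mul_pyramidVertex_last] using hcv (Fin.last e)
  refine Fin.lastCases hlast fun i => ?_
  rw [Fin.sum_univ_castSucc, hlast, add_zero] at hc
  refine hq.eq_zero_of_sum_eq_zero hc ?_ i (Finset.mem_univ i)
  ext j
  simpa [sum_mul_pyramidVertex_castSucc] using hcv j.castSucc

theorem mem_coneLattice_pyramidVertex {n e : ℕ} {q : Fin n → Fin e → ℝ} {c : Fin (n + 1) → ℝ} :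
    c ∈ coneLattice (pyramidVertex q) ↔
      (fun i => c (Fin.castSucc i)) ∈ coneLattice q ∧ c (Fin.last n) ∈ intSubgroup := by
  simp only [mem_coneLattice, Fin.forall_fin_succ', sum_mul_pyramidVertex_castSucc,
    sum_mul_pyramidVertex_last, Fin.sum_univ_castSucc c]
  constructor
  · rintro ⟨⟨h1, h2⟩, h3⟩
    exact ⟨⟨h1, by simpa using sub_mem h3 h2⟩, h2⟩
  · rintro ⟨⟨h1, h3⟩, h2⟩
    exact ⟨⟨h1, h2⟩, add_mem h3 h2⟩

theorem pyramidOver_convexHull_range {n e : ℕ} (q : Fin n → Fin e → ℝ) :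
    pyramidOver (convexHull ℝ (Set.range q)) = convexHull ℝ (Set.range (pyramidVertex q)) := by
  let f : (Fin e → ℝ) →ₗ[ℝ] (Fin (e + 1) → ℝ) :=
    { toFun := fun x => Fin.snoc (α := fun _ => ℝ) x 0
      map_add' := fun x y => by
        ext j
        refine Fin.lastCases ?_ (fun j => ?_) j <;> simp
      map_smul' := fun r x => by
        ext j
        refine Fin.lastCases ?_ (fun j => ?_) j <;> simp }
  have h : (fun x : Fin e → ℝ => (Fin.snoc x (0 : ℝ) : Fin (e + 1) → ℝ)) ''
      convexHull ℝ (Set.range q) = convexHull ℝ (f '' Set.range q) :=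
    f.image_convexHull _
  rw [pyramidOver, h, convexHull_convexHull_union_left]
  congr 1
  ext x
  simp only [Set.mem_union, Set.mem_image, Set.mem_range, Set.mem_singleton_iff,
    Fin.exists_fin_succ', pyramidVertex, Fin.snoc_castSucc, Fin.snoc_last, exists_exists_eq_and]
  exact or_congr Iff.rfl eq_comm

theorem exists_perm_apply_eq {α : Type*} [DecidableEq α] {x₁ x₂ y₁ y₂ : α} (hx : x₁ ≠ x₂)
    (hy : y₁ ≠ y₂) : ∃ σ : Equiv.Perm α, σ x₁ = y₁ ∧ σ x₂ = y₂ := by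
  have h : Equiv.swap x₁ y₁ y₂ ≠ x₁ := by
    rw [Ne, Equiv.swap_apply_eq_iff, Equiv.swap_apply_left]
    exact hy.symm
  refine ⟨Equiv.swap x₁ y₁ * Equiv.swap x₂ (Equiv.swap x₁ y₁ y₂), ?_, ?_⟩
  · rw [Equiv.Perm.mul_apply, Equiv.swap_apply_of_ne_of_ne hx h.symm, Equiv.swap_apply_left]
  · rw [Equiv.Perm.mul_apply, Equiv.swap_apply_left, Equiv.swap_apply_self]

theorem isLatticePyramid_of_last_eq_zero {k : ℕ} {v : Fin (k + 3) → Fin (k + 2) → ℝ}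
    (hv : AffineIndependent ℝ v) {m : Fin (k + 3) → ℤ} (hms : 3 ∣ ∑ i, m i)
    (h : ∀ c, c ∈ coneLattice v ↔ c ∈ thirdLattice m) (hlast : m (Fin.last (k + 2)) = 0)
    (hm : 3 ∣ m (Fin.last (k + 1)).castSucc - 1) :
    IsLatticePyramid (convexHull ℝ (Set.range v)) := by
  let a : Fin (k + 1) → ℤ := fun i => if i = Fin.last k then 3 else -m i.succ.castSucc
  have ha : a (Fin.last k) = 3 := if_pos rfl
  have hq := affineIndependent_normalFormVertex ha
  rw [Fin.sum_univ_castSucc, hlast, add_zero] at hms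
  have hL := mem_coneLattice_normalFormVertex ha (m := fun i => m i.castSucc) hm
    (fun i => by simp [a, (Fin.castSucc_lt_last _).ne]) hms
  refine ⟨k + 1, convexHull ℝ (Set.range (normalFormVertex a)),
    ⟨Finset.univ.image (normalFormVertex a), ?_, by simp⟩,
    affineSpan_convexHull_range_eq_top hq, ?_⟩
  · simpa [Set.range_subset_iff] using normalFormVertex_mem_latticePts a
  · rw [pyramidOver_convexHull_range]
    refine unimodEquiv_of_coneLattice_eq hv (affineIndependent_pyramidVertex hq) ?_
    ext c
    rw [h, mem_coneLattice_pyramidVertex, hL]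
    constructor
    · rintro ⟨t, ht⟩
      exact ⟨⟨t, fun i => ht i.castSucc⟩, by simpa [hlast] using ht (Fin.last _)⟩
    · rintro ⟨⟨t, ht⟩, hc⟩
      exact ⟨t, Fin.lastCases (by simpa [hlast] using hc) ht⟩

theorem isLatticePyramid_of_exists_eq_zero {d i1 : ℕ} (hi1 : 1 ≤ i1)
    {v : Fin (d + 1) → Fin d → ℝ} (hv : AffineIndependent ℝ v) {m : Fin (d + 1) → ℤ}
    (hm : ∀ i, 0 ≤ m i ∧ m i ≤ 2) (hms : ∑ i, m i = 3 * i1)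
    (h : ∀ c, c ∈ coneLattice v ↔ c ∈ thirdLattice m) {i : Fin (d + 1)} (hi : m i = 0) :
    IsLatticePyramid (convexHull ℝ (Set.range v)) := by
  obtain _ | _ | k := d
  · rw [Subsingleton.elim (α := Fin 1) i 0] at hi
    rw [Fin.sum_univ_one, hi] at hms
    omega
  · have h0 := hm 0
    have h1 := hm 1
    rw [Fin.sum_univ_two] at hms
    fin_cases i
    · change m 0 = 0 at hi; omega
    · change m 1 = 0 at hi; omega
  obtain ⟨j, hj⟩ : ∃ j, m j ≠ 0 := by
    by_contra! h0
    rw [Finset.sum_eq_zero fun i _ => h0 i] at hms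
    omega
  obtain ⟨σ, hσ, hσ'⟩ := exists_perm_apply_eq (x₁ := Fin.last (k + 2))
    (x₂ := (Fin.last (k + 1)).castSucc) (Fin.castSucc_lt_last _).ne'
    (show i ≠ j from fun hij => hj (hij ▸ hi))
  rw [← σ.surjective.range_comp v]
  have hvσ : AffineIndependent ℝ (v ∘ σ) := hv.comp_embedding σ.toEmbedding
  have hmσ : ∑ i, (m ∘ σ) i = 3 * i1 := by
    rw [← hms]
    exact Equiv.sum_comp σ m
  have hj' := hm j
  obtain hj1 | hj2 : m j = 1 ∨ m j = 2 := by omega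
  · refine isLatticePyramid_of_last_eq_zero hvσ ⟨i1, hmσ⟩ (mem_coneLattice_comp_iff h σ) ?_ ?_
    · simp [hσ, hi]
    · simp [hσ', hj1]
  · refine isLatticePyramid_of_last_eq_zero hvσ (m := -(m ∘ σ)) ⟨-i1, ?_⟩ (fun c => ?_) ?_ ?_
    · simp only [Pi.neg_apply, Finset.sum_neg_distrib, hmσ]
      ring
    · rw [thirdLattice_neg, mem_coneLattice_comp_iff h σ]
    · simp [hσ, hi]
    · simp [hσ', hj2]

/-- The last vertex of `deltaThreeSimplex (k + 1) i1 i2`. -/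
def deltaThreeApex (k i1 i2 : ℕ) : Fin (k + 1) → ℤ := fun j =>
  if (j : ℕ) = k then 3 else if (j : ℕ) + i1 + 2 ≤ 2 * i2 then 2 else 1

theorem deltaThreeSimplex_eq (k i1 i2 : ℕ) : deltaThreeSimplex (k + 1) i1 i2 =
    convexHull ℝ (Set.range (normalFormVertex (deltaThreeApex k i1 i2))) := by
  rw [deltaThreeSimplex]
  congr 1
  ext x
  simp only [Set.mem_union, Set.mem_insert_iff, Set.mem_singleton_iff, Set.mem_ofPred_eq,
    Set.mem_range, Fin.exists_fin_succ (P := fun i => normalFormVertex _ i = x),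
    Fin.exists_fin_succ' (P := fun i => normalFormVertex _ (Fin.succ i) = x), Fin.succ_last,
    Nat.succ_eq_add_one, normalFormVertex_zero, normalFormVertex_last,
    normalFormVertex_castSucc_succ, Nat.add_sub_cancel, Fin.exists_fin_succ', Fin.val_last,
    Fin.val_castSucc, Fin.is_lt, lt_irrefl, true_and, false_and, or_false]
  have hw : (fun j => (deltaThreeApex k i1 i2 j : ℝ)) = fun j : Fin (k + 1) =>
      if (j : ℕ) = k then (3 : ℝ) else if (j : ℕ) + i1 + 2 ≤ 2 * i2 then 2 else 1 := by
    ext j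
    simp only [deltaThreeApex]
    split_ifs <;> norm_num
  rw [hw]
  simp only [eq_comm (b := x)]
  tauto

theorem exists_perm_apply_iff {α : Type*} [Fintype α] {p q : α → Prop} [DecidablePred p]
    [DecidablePred q] (h : (Finset.univ.filter p).card = (Finset.univ.filter q).card) :
    ∃ σ : Equiv.Perm α, ∀ x, q (σ x) ↔ p x := by
  have e : {x // p x} ≃ {x // q x} :=
    Fintype.equivOfCardEq (by rwa [Fintype.card_subtype, Fintype.card_subtype])
  refine ⟨e.extendSubtype, fun x => ⟨fun hq => ?_, e.extendSubtype_mem x⟩⟩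
  by_contra hp
  exact e.extendSubtype_not_mem x hp hq

theorem card_filter_eq_one {n i1 i2 : ℕ} {m : Fin n → ℤ} (hm : ∀ i, m i = 1 ∨ m i = 2)
    (hms : ∑ i, m i = 3 * i1) (hn : i1 + i2 = n) :
    ((Finset.univ.filter fun i => m i = 1).card : ℤ) = 2 * i2 - i1 := by
  have h (i) : m i = 2 - if m i = 1 then 1 else 0 := by
    obtain h | h := hm i <;> rw [h] <;> norm_num
  rw [Finset.sum_congr rfl fun i _ => h i, Finset.sum_sub_distrib, Finset.sum_boole] at hms
  simp only [Finset.sum_const, Finset.card_univ, Fintype.card_fin, nsmul_eq_mul] at hms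
  omega

theorem card_filter_deltaThree {k i1 i2 : ℕ} (h12 : i1 ≤ i2)
    (h21 : i2 ≤ 2 * i1) (hk : i1 + i2 = k + 2) :
    (Finset.univ.filter fun x : Fin (k + 2) => (x : ℕ) = k + 1 ∨
      (1 ≤ (x : ℕ) ∧ (x : ℕ) + i1 + 1 ≤ 2 * i2) ∨ i2 = 2 * i1).card = 2 * i2 - i1 := by
  by_cases h : i2 = 2 * i1
  · simp only [h, or_true, Finset.filter_true, Finset.card_univ, Fintype.card_fin]
    omega
  · rw [← Finset.card_map Fin.valEmbedding]
    have : (Finset.univ.filter fun x : Fin (k + 2) => (x : ℕ) = k + 1 ∨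
        (1 ≤ (x : ℕ) ∧ (x : ℕ) + i1 + 1 ≤ 2 * i2) ∨ i2 = 2 * i1).map Fin.valEmbedding =
        insert (k + 1) (Finset.Icc 1 (2 * i2 - i1 - 1)) := by
      ext x
      simp only [Finset.mem_map, Finset.mem_filter, Finset.mem_univ, true_and,
        Fin.valEmbedding_apply, Finset.mem_insert, Finset.mem_Icc]
      constructor
      · rintro ⟨y, hy, rfl⟩
        omega
      · intro hx
        exact ⟨⟨x, by omega⟩, by simp only; omega, rfl⟩
    rw [this, Finset.card_insert_of_notMem (by simp only [Finset.mem_Icc]; omega), Nat.card_Icc]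
    omega

theorem unimodEquiv_deltaThreeSimplex {k i1 i2 : ℕ} (h12 : i1 ≤ i2)
    (hk : i1 + i2 = k + 2) {v : Fin (k + 2) → Fin (k + 1) → ℝ} (hv : AffineIndependent ℝ v)
    {m : Fin (k + 2) → ℤ} (hm : ∀ i, m i = 1 ∨ m i = 2) (hms : ∑ i, m i = 3 * i1)
    (h : ∀ c, c ∈ coneLattice v ↔ c ∈ thirdLattice m) :
    UnimodEquiv (convexHull ℝ (Set.range v)) (deltaThreeSimplex (k + 1) i1 i2) := by
  have hcard := card_filter_eq_one hm hms hk
  have hcard_le := Finset.card_filter_le (Finset.univ : Finset (Fin (k + 2))) fun i => m i = 1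
  rw [Finset.card_univ, Fintype.card_fin] at hcard_le
  have hcard' := card_filter_deltaThree h12 (by omega) hk
  obtain ⟨σ, hσ⟩ := exists_perm_apply_iff (hcard'.trans
    (show _ = (Finset.univ.filter fun i => m i = 1).card by omega))
  have ha : deltaThreeApex k i1 i2 (Fin.last k) = 3 := by simp [deltaThreeApex]
  have hmσ : ∑ i, (m ∘ σ) i = 3 * i1 := by
    rw [← hms]
    exact Equiv.sum_comp σ m
  rw [deltaThreeSimplex_eq, ← σ.surjective.range_comp v]
  refine unimodEquiv_of_coneLattice_eq (hv.comp_embedding σ.toEmbedding)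
    (affineIndependent_normalFormVertex ha) ?_
  ext c
  rw [mem_coneLattice_normalFormVertex ha (m := m ∘ σ) ?_ (fun i => ?_) ⟨i1, hmσ⟩]
  · exact mem_coneLattice_comp_iff h σ c
  · simp [(hσ (Fin.last (k + 1))).2 (by simp)]
  · have h1 := hσ i.castSucc.succ
    have h2 := hm (σ i.castSucc.succ)
    have h3 := i.is_lt
    simp only [Fin.val_succ, Fin.val_castSucc] at h1
    simp only [Function.comp_apply, deltaThreeApex, Fin.val_castSucc, h3.ne, if_false]
    split_ifs with h4 <;> omega

/-- classification of lattice simplices of normalized volume 3 which are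
not lattice pyramids. -/
theorem simplex_volume_three_classification {d i1 i2 : ℕ} (hi1 : 1 ≤ i1) (h12 : i1 ≤ i2)
    (Δ : Set (Fin d → ℝ)) (hΔ : IsLatticeSimplexFD Δ)
    (hδ : HasDeltaPoly Δ (1 + X ^ i1 + X ^ i2))
    (hpyr : ¬ IsLatticePyramid Δ) :
    d = i1 + i2 - 1 ∧ UnimodEquiv Δ (deltaThreeSimplex d i1 i2) := by
  obtain ⟨v, hv, hvl, rfl⟩ := hΔ
  obtain ⟨m, hm, hms, hL, hd⟩ := exists_generator_of_hasDeltaPoly hi1 hv hvl hδ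
  have hm0 (i) : m i ≠ 0 := fun hi =>
    hpyr (isLatticePyramid_of_exists_eq_zero hi1 hv hm hms hL hi)
  have hdim := hd hm0
  obtain _ | k := d
  · omega
  refine ⟨by omega, unimodEquiv_deltaThreeSimplex h12 hdim hv (fun i => ?_) hms hL⟩
  have h1 := hm i
  have h2 := hm0 i
  omega
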